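/- Let G be a finitely generated group whose Cayley graph (with respect to some finite generating set A) is a Morse local-to-global space. Then the set Q_*(G) = { g⁺ : g is a Morse element of G } of attracting fixed points of Morse elements is dense in the Morse boundary ∂_*G. -/

import Mathlib

open Classical

/-- Evaluation in `G` of a word over the alphabet `A`. -/
def wordEval {G : Type} [Group G] {A : Type} (π : A → G) (w : List A) : G :=
  (w.map π).prod

/-- `π : A → G` generates `G` (positive words suffice; the generating set is
assumed symmetric, see `SymmetricGen`). -/
def Generates {G : Type} [Group G] {A : Type} (π : A → G) : Prop :=
  ∀ g : G, ∃ w : List A, wordEval π w = g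

/-- The generating set is symmetric: `A = A⁻¹`. -/
def SymmetricGen {G : Type} [Group G] {A : Type} (π : A → G) : Prop :=
  ∀ a : A, ∃ b : A, π b = (π a)⁻¹

/-- The word length of `g` with respect to the generating map `π`. -/
noncomputable def wordLength {G : Type} [Group G] {A : Type} (π : A → G) (g : G) : ℕ :=
  sInf {n : ℕ | ∃ w : List A, w.length = n ∧ wordEval π w = g}

/-- The word metric on `G` induced by the generating map `π`. -/
noncomputable def wordDist {G : Type} [Group G] {A : Type} (π : A → G) (g h : G) : ℕ :=
  wordLength π (g⁻¹ * h)

/-- A Morse gauge: a function `M : (k, c) ↦ M(k,c)`. -/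
def MorseGauge : Type := ℝ → ℝ → ℝ

/-- `q : {0,…,n} → G` is a discrete `(k,c)`-quasi-geodesic in the Cayley
graph of `G` with respect to `π`. -/
noncomputable def IsDiscreteQG {G : Type} [Group G] {A : Type} (π : A → G)
    (k c : ℝ) (q : ℕ → G) (n : ℕ) : Prop :=
  ∀ i ≤ n, ∀ j ≤ n,
    (1 / k) * |(i : ℝ) - (j : ℝ)| - c ≤ (wordDist π (q i) (q j) : ℝ) ∧
    (wordDist π (q i) (q j) : ℝ) ≤ k * |(i : ℝ) - (j : ℝ)| + c

/-- `q : {0,…,n} → G` is a discrete geodesic in the Cayley graph. -/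
def IsDiscreteGeodesic {G : Type} [Group G] {A : Type} (π : A → G)
    (q : ℕ → G) (n : ℕ) : Prop :=
  ∀ i ≤ n, ∀ j ≤ n, wordDist π (q i) (q j) = Nat.dist i j

/-- The discrete path `q : {0,…,n} → G` is `M`-Morse: every discrete
`(k,c)`-quasi-geodesic with endpoints on `q` stays within `M k c` of the
subsegment of `q` between those endpoints. -/
def IsMorsePath {G : Type} [Group G] {A : Type} (π : A → G)
    (M : MorseGauge) (q : ℕ → G) (n : ℕ) : Prop :=
  ∀ k c : ℝ, 1 ≤ k → 0 ≤ c →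
    ∀ (p : ℕ → G) (m : ℕ), IsDiscreteQG π k c p m →
      ∀ i j : ℕ, i ≤ j → j ≤ n → p 0 = q i → p m = q j →
        ∀ l ≤ m, ∃ i' : ℕ, i ≤ i' ∧ i' ≤ j ∧ (wordDist π (p l) (q i') : ℝ) ≤ M k c

/-- The path in the Cayley graph labeled by the word `w`, starting at the
identity: `i ↦` the evaluation of the `i`-th prefix of `w`. -/
def wordPath {G : Type} [Group G] {A : Type} (π : A → G) (w : List A) (i : ℕ) : G :=
  wordEval π (w.take i)

/-- `w` is a geodesic word: its length realizes the word length of the element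
it represents. -/
def IsGeodesicWord {G : Type} [Group G] {A : Type} (π : A → G) (w : List A) : Prop :=
  w.length = wordLength π (wordEval π w)

/-- The path labeled by `w` is a `(B; M)`-local Morse geodesic: every subpath
of length at most `B` is an `M`-Morse (geodesic) path. -/
def IsLocalMorseWord {G : Type} [Group G] {A : Type} (π : A → G)
    (M : MorseGauge) (B : ℝ) (w : List A) : Prop :=
  ∀ i j : ℕ, i ≤ j → j ≤ w.length → (j : ℝ) - (i : ℝ) ≤ B →
    IsMorsePath π M (fun t => wordPath π w (i + t)) (j - i)

/-- `q : {0,…,n} → G` is a `(B; M; k, c)`-local Morse quasi-geodesic. -/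
noncomputable def IsLocalMorseQG {G : Type} [Group G] {A : Type} (π : A → G)
    (B : ℝ) (M : MorseGauge) (k c : ℝ) (q : ℕ → G) (n : ℕ) : Prop :=
  ∀ i j : ℕ, i ≤ j → j ≤ n → (j : ℝ) - (i : ℝ) ≤ B →
    IsDiscreteQG π k c (fun t => q (i + t)) (j - i) ∧
    IsMorsePath π M (fun t => q (i + t)) (j - i)

/-- The Cayley graph of `G` with respect to `π` has the Morse local-to-global
property: local Morse quasi-geodesics of sufficiently large local scale are
global Morse quasi-geodesics. -/
noncomputable def MorseLocalToGlobal {G : Type} [Group G] {A : Type} (π : A → G) : Prop :=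
  ∀ (M : MorseGauge) (k c : ℝ), 1 ≤ k → 0 ≤ c →
    ∃ (B : ℝ) (M' : MorseGauge) (k' c' : ℝ), 0 ≤ B ∧ 1 ≤ k' ∧ 0 ≤ c' ∧
      ∀ (q : ℕ → G) (n : ℕ), IsLocalMorseQG π B M k c q n →
        IsDiscreteQG π k' c' q n ∧ IsMorsePath π M' q n

/-- `H` is `(M,k)`-stable in the Cayley graph of `G` with respect to `π`:
every geodesic word from the identity to an element of `H` is `M`-Morse and
all its vertices lie within distance `k` of `H`. -/
def IsStable {G : Type} [Group G] {A : Type} (π : A → G)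
    (H : Subgroup G) (M : MorseGauge) (k : ℕ) : Prop :=
  ∀ h ∈ H, ∀ w : List A, wordEval π w = h → IsGeodesicWord π w →
    IsMorsePath π M (wordPath π w) w.length ∧
    ∀ i ≤ w.length, ∃ h' ∈ H, wordDist π (wordPath π w i) h' ≤ k

/-- A geodesic ray in the Cayley graph based at the identity. -/
def IsRay {G : Type} [Group G] {A : Type} (π : A → G) (γ : ℕ → G) : Prop :=
  γ 0 = 1 ∧ ∀ i j : ℕ, wordDist π (γ i) (γ j) = Nat.dist i j

/-- An `M`-Morse geodesic ray based at the identity. -/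
def IsMorseRay {G : Type} [Group G] {A : Type} (π : A → G)
    (M : MorseGauge) (γ : ℕ → G) : Prop :=
  IsRay π γ ∧ ∀ n : ℕ, IsMorsePath π M γ n

/-- Two rays are asymptotic if they stay at uniformly bounded distance. -/
def RayEquiv {G : Type} [Group G] {A : Type} (π : A → G) (γ δ : ℕ → G) : Prop :=
  ∃ C : ℕ, ∀ n : ℕ, wordDist π (γ n) (δ n) ≤ C

/-- The set of Morse geodesic rays based at the identity (any gauge). -/
def MorseRays {G : Type} [Group G] {A : Type} (π : A → G) : Type :=
  {γ : ℕ → G // ∃ M : MorseGauge, IsMorseRay π M γ}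

/-- The Morse boundary of `G` (with respect to `π`) as a set: Morse geodesic
rays based at the identity modulo asymptotic equivalence. -/
def MorseBoundary {G : Type} [Group G] {A : Type} (π : A → G) : Type :=
  Quot (fun γ δ : MorseRays π => RayEquiv π γ.1 δ.1)

/-- The boundary point determined by an `M`-Morse ray. -/
def mkBoundary {G : Type} [Group G] {A : Type} (π : A → G)
    (γ : ℕ → G) (M : MorseGauge) (h : IsMorseRay π M γ) : MorseBoundary π :=
  Quot.mk _ (⟨γ, M, h⟩ : MorseRays π)

/-- The stratum of `M`-Morse rays, carrying the compact-open topology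
(equivalently, the topology of pointwise convergence, `G` being discrete). -/
def stratumTop {G : Type} [Group G] {A : Type} (π : A → G) (M : MorseGauge) :
    TopologicalSpace {γ : ℕ → G // IsMorseRay π M γ} :=
  letI : TopologicalSpace G := ⊥
  inferInstance

/-- The Morse boundary carries the direct limit topology over the strata of
`M`-Morse rays. -/
noncomputable def boundaryTop {G : Type} [Group G] {A : Type} (π : A → G) :
    TopologicalSpace (MorseBoundary π) :=
  ⨆ M : MorseGauge,
    TopologicalSpace.coinduced
      (fun γ : {γ : ℕ → G // IsMorseRay π M γ} => mkBoundary π γ.1 M γ.2)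
      (stratumTop π M)

/-- The sequence of paths labeled by the geodesic words `w n` converges
uniformly on compact sets to the ray `γ`. -/
def ConvergesTo {G : Type} [Group G] {A : Type} (π : A → G)
    (w : ℕ → List A) (γ : ℕ → G) : Prop :=
  ∀ m : ℕ, ∃ N : ℕ, ∀ n ≥ N, m ≤ (w n).length ∧ ∀ t ≤ m, wordPath π (w n) t = γ t

/-- The limit set of a subgroup `H` in the Morse boundary: boundary points
represented by limits of uniformly Morse geodesics from the identity to
elements of `H`. -/
def limitSet {G : Type} [Group G] {A : Type} (π : A → G) (H : Subgroup G) :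
    Set (MorseBoundary π) :=
  {x | ∃ (M : MorseGauge) (γ : ℕ → G) (hγ : IsMorseRay π M γ),
    mkBoundary π γ M hγ = x ∧
    ∃ w : ℕ → List A,
      (∀ n : ℕ, IsGeodesicWord π (w n) ∧ wordEval π (w n) ∈ H ∧
        IsMorsePath π M (wordPath π (w n)) (w n).length) ∧
      ConvergesTo π w γ}

/-- `g` is a Morse element: the cyclic subgroup `⟨g⟩` is stable. -/
def IsMorseElement {G : Type} [Group G] {A : Type} (π : A → G) (g : G) : Prop :=
  ∃ (M : MorseGauge) (k : ℕ), IsStable π (Subgroup.zpowers g) M k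

/-- `x` is the attracting fixed point `g⁺` of `g`: `x` is represented by a
Morse ray which is the limit of geodesics from the identity to the powers
`g ^ n`. -/
def IsPlusPoint {G : Type} [Group G] {A : Type} (π : A → G)
    (g : G) (x : MorseBoundary π) : Prop :=
  ∃ (M : MorseGauge) (γ : ℕ → G) (hγ : IsMorseRay π M γ),
    mkBoundary π γ M hγ = x ∧
    ∃ w : ℕ → List A,
      (∀ n : ℕ, IsGeodesicWord π (w n) ∧ wordEval π (w n) = g ^ n) ∧
      ConvergesTo π w γ

section basics
variable {G : Type} [Group G] {A : Type} {π : A → G}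

lemma wordEval_append (u v : List A) : wordEval π (u ++ v) = wordEval π u * wordEval π v := by
  simp [wordEval]

lemma wordEval_nil : wordEval π ([] : List A) = 1 := by simp [wordEval]

lemma wordLength_le (w : List A) : wordLength π (wordEval π w) ≤ w.length :=
  Nat.sInf_le ⟨w, rfl, rfl⟩

lemma exists_geod (hgen : Generates π) (g : G) :
    ∃ w : List A, wordEval π w = g ∧ w.length = wordLength π g := by
  have : {n : ℕ | ∃ w : List A, w.length = n ∧ wordEval π w = g}.Nonempty := by
    obtain ⟨w, hw⟩ := hgen g
    exact ⟨_, w, rfl, hw⟩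
  obtain ⟨w, h1, h2⟩ := Nat.sInf_mem this
  exact ⟨w, h2, h1⟩

lemma wordLength_one : wordLength π (1 : G) = 0 := by
  have := wordLength_le (π := π) []
  simpa [wordEval_nil] using this

lemma wordLength_mul_le (hgen : Generates π) (g h : G) :
    wordLength π (g * h) ≤ wordLength π g + wordLength π h := by
  obtain ⟨u, hu, hu'⟩ := exists_geod hgen g
  obtain ⟨v, hv, hv'⟩ := exists_geod hgen h
  have := wordLength_le (π := π) (u ++ v)
  rw [wordEval_append, hu, hv] at this
  simpa [hu', hv'] using this

lemma exists_inv_word (hsym : SymmetricGen π) (w : List A) :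
    ∃ v : List A, v.length = w.length ∧ wordEval π v = (wordEval π w)⁻¹ := by
  induction w with
  | nil => exact ⟨[], rfl, by simp [wordEval]⟩
  | cons a w ih =>
    obtain ⟨v, h1, h2⟩ := ih
    obtain ⟨b, hb⟩ := hsym a
    refine ⟨v ++ [b], by simp [h1], ?_⟩
    rw [wordEval_append, h2]
    simp [wordEval, hb]

lemma wordLength_inv_le (hgen : Generates π) (hsym : SymmetricGen π) (g : G) :
    wordLength π g⁻¹ ≤ wordLength π g := by
  obtain ⟨w, hw, hw'⟩ := exists_geod hgen g
  obtain ⟨v, h1, h2⟩ := exists_inv_word hsym w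
  have := wordLength_le (π := π) v
  rw [h2, hw] at this
  omega

lemma wd_self (x : G) : wordDist π x x = 0 := by simp [wordDist, wordLength_one]

lemma wd_comm (hgen : Generates π) (hsym : SymmetricGen π) (x y : G) :
    wordDist π x y = wordDist π y x := by
  have h1 := wordLength_inv_le hgen hsym (x⁻¹ * y)
  have h2 := wordLength_inv_le hgen hsym (y⁻¹ * x)
  simp only [mul_inv_rev, inv_inv] at h1 h2
  exact le_antisymm h2 h1

lemma wd_tri (hgen : Generates π) (x y z : G) :
    wordDist π x z ≤ wordDist π x y + wordDist π y z := by
  have := wordLength_mul_le hgen (x⁻¹ * y) (y⁻¹ * z)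
  simpa [wordDist, mul_assoc] using this

lemma wd_triR (hgen : Generates π) (x y z : G) :
    (wordDist π x z : ℝ) ≤ wordDist π x y + wordDist π y z := by
  exact_mod_cast wd_tri hgen x y z

lemma wd_mul (g x y : G) : wordDist π (g * x) (g * y) = wordDist π x y := by
  simp [wordDist, mul_assoc]

lemma wd_nonneg (x y : G) : (0 : ℝ) ≤ wordDist π x y := Nat.cast_nonneg _

lemma wd_one (x : G) : wordDist π 1 x = wordLength π x := by simp [wordDist]

lemma ball_finite [Fintype A] (hgen : Generates π) (n : ℕ) :
    {g : G | wordLength π g ≤ n}.Finite := by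
  refine ((List.finite_length_le A n).image (wordEval π)).subset ?_
  intro g hg
  obtain ⟨w, hw, hw'⟩ := exists_geod hgen g
  exact ⟨w, by simpa [hw'] using hg, hw⟩

lemma natdist_cast (i j : ℕ) : ((Nat.dist i j : ℕ) : ℝ) = |(i : ℝ) - j| := by
  rcases le_total i j with h | h
  · rw [Nat.dist_eq_sub_of_le h, abs_sub_comm, abs_of_nonneg (by simpa using h), Nat.cast_sub h]
  · rw [Nat.dist_eq_sub_of_le_right h, abs_of_nonneg (by simpa using h), Nat.cast_sub h]

lemma geo_iff (σ : ℕ → G) (n : ℕ) :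
    IsDiscreteQG π 1 0 σ n ↔ ∀ i ≤ n, ∀ j ≤ n, wordDist π (σ i) (σ j) = Nat.dist i j := by
  unfold IsDiscreteQG
  refine forall₂_congr fun i _ => forall₂_congr fun j _ => ?_
  rw [← natdist_cast]
  constructor
  · rintro ⟨h1, h2⟩
    have : (wordDist π (σ i) (σ j) : ℝ) = (Nat.dist i j : ℕ) := by
      linarith
    exact_mod_cast this
  · intro h
    rw [h]; constructor <;> linarith

lemma geo_dist {σ : ℕ → G} {n : ℕ} (h : IsDiscreteQG π 1 0 σ n) {i j : ℕ} (hij : i ≤ j)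
    (hj : j ≤ n) : wordDist π (σ i) (σ j) = j - i := by
  rw [(geo_iff σ n).1 h i (hij.trans hj) j hj, Nat.dist_eq_sub_of_le hij]

lemma geo_of (hgen : Generates π) (hsym : SymmetricGen π) {σ : ℕ → G} {n : ℕ}
    (h : ∀ i j, i ≤ j → j ≤ n → wordDist π (σ i) (σ j) = j - i) : IsDiscreteQG π 1 0 σ n := by
  rw [geo_iff]
  intro i hi j hj
  rcases le_total i j with h' | h'
  · rw [h i j h' hj, Nat.dist_eq_sub_of_le h']
  · rw [wd_comm hgen hsym, h j i h' hi, Nat.dist_eq_sub_of_le_right h']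

lemma wordPath_zero (w : List A) : wordPath π w 0 = 1 := by simp [wordPath, wordEval]

lemma wordPath_len (w : List A) : wordPath π w w.length = wordEval π w := by
  simp [wordPath]

lemma wordPath_split (w : List A) {i j : ℕ} (hij : i ≤ j) :
    wordPath π w j = wordPath π w i * wordEval π ((w.drop i).take (j - i)) := by
  rw [wordPath, wordPath, ← wordEval_append, ← List.take_add]
  congr 2; omega

lemma wordPath_dist_le (w : List A) {i j : ℕ} (hij : i ≤ j) :
    wordDist π (wordPath π w i) (wordPath π w j) ≤ j - i := by
  rw [wordPath_split w hij, wordDist, inv_mul_cancel_left]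
  refine (wordLength_le _).trans ?_
  simp

lemma geo_wordPath (hgen : Generates π) (hsym : SymmetricGen π) {w : List A}
    (hw : IsGeodesicWord π w) : IsDiscreteQG π 1 0 (wordPath π w) w.length := by
  refine geo_of hgen hsym fun i j hij hj => ?_
  have h1 := wordPath_dist_le (π := π) w hij
  have h2 := wordPath_dist_le (π := π) w (Nat.zero_le i)
  have h3 := wordPath_dist_le (π := π) w hj
  have h4 := wd_tri hgen (wordPath π w 0) (wordPath π w i) (wordPath π w w.length)
  have h5 := wd_tri hgen (wordPath π w i) (wordPath π w j) (wordPath π w w.length)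
  have h6 : wordDist π (wordPath π w 0) (wordPath π w w.length) = w.length := by
    rw [wordPath_zero, wd_one, wordPath_len]; exact hw.symm
  omega

lemma exists_geo (hgen : Generates π) (hsym : SymmetricGen π) (a b : G) :
    ∃ σ : ℕ → G, σ 0 = a ∧ σ (wordDist π a b) = b ∧ IsDiscreteQG π 1 0 σ (wordDist π a b) := by
  obtain ⟨w, hw, hw'⟩ := exists_geod hgen (a⁻¹ * b)
  have hl : w.length = wordDist π a b := hw'
  have hgw : IsGeodesicWord π w := by rw [IsGeodesicWord, hw, hw']
  refine ⟨fun i => a * wordPath π w i, by simp [wordPath_zero], ?_, ?_⟩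
  · simp only; rw [← hl, wordPath_len, hw]; group
  · have := geo_wordPath hgen hsym hgw
    rw [hl] at this
    intro i hi j hj
    simp only [wd_mul]
    exact this i hi j hj

end basics
section morse
variable {G : Type} [Group G] {A : Type} {π : A → G}

lemma qg_mono {k c c' : ℝ} {p : ℕ → G} {m n : ℕ} (h : IsDiscreteQG π k c p m) (hn : n ≤ m)
    (hc : c ≤ c') : IsDiscreteQG π k c' p n := by
  intro i hi j hj
  have := h i (hi.trans hn) j (hj.trans hn)
  constructor <;> linarith

lemma qg_mono_k {k k' c : ℝ} {p : ℕ → G} {m : ℕ} (hk : 0 < k) (h : IsDiscreteQG π k c p m)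
    (hkk : k ≤ k') : IsDiscreteQG π k' c p m := by
  intro i hi j hj
  have h1 := h i hi j hj
  have h2 : (1 / k') * |(i : ℝ) - j| ≤ (1 / k) * |(i : ℝ) - j| := by
    gcongr
  have h3 : k * |(i : ℝ) - j| ≤ k' * |(i : ℝ) - j| := by gcongr
  constructor <;> linarith

lemma qg_shift {k c : ℝ} {p : ℕ → G} {m : ℕ} (h : IsDiscreteQG π k c p m) {i j : ℕ}
    (hij : i ≤ j) (hj : j ≤ m) : IsDiscreteQG π k c (fun t => p (i + t)) (j - i) := by
  intro a ha b hb
  have := h (i + a) (by omega) (i + b) (by omega)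
  push_cast at this
  simpa using this

lemma qg_congr {k c : ℝ} {p p' : ℕ → G} {m : ℕ} (h : IsDiscreteQG π k c p m) (x : G)
    (hp : ∀ i ≤ m, p' i = x * p i) : IsDiscreteQG π k c p' m := by
  intro i hi j hj
  rw [hp i hi, hp j hj, wd_mul]
  exact h i hi j hj

lemma qg_rev {k c : ℝ} {p : ℕ → G} {m : ℕ} (h : IsDiscreteQG π k c p m) :
    IsDiscreteQG π k c (fun t => p (m - t)) m := by
  intro a ha b hb
  have := h (m - a) (by omega) (m - b) (by omega)
  rw [Nat.cast_sub ha, Nat.cast_sub hb] at this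
  have e : |((m : ℝ) - a) - (m - b)| = |(a : ℝ) - b| := by
    rw [abs_sub_comm]; congr 1; ring
  rwa [e] at this

lemma qg_reparam (hgen : Generates π) (hsym : SymmetricGen π) {k c D : ℝ} (hk : 1 ≤ k)
    {p p' : ℕ → G} {m m' : ℕ} (h : IsDiscreteQG π k c p m) (f : ℕ → ℕ)
    (hf : ∀ i ≤ m', f i ≤ m)
    (hff : ∀ i ≤ m', ∀ j ≤ m', |(f i : ℝ) - f j| ≤ |(i : ℝ) - j| + 2 ∧
      |(i : ℝ) - j| ≤ |(f i : ℝ) - f j| + 2)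
    (hD : ∀ i ≤ m', (wordDist π (p' i) (p (f i)) : ℝ) ≤ D) :
    IsDiscreteQG π k (c + 2 * k + 2 * D) p' m' := by
  intro i hi j hj
  obtain ⟨h1, h2⟩ := h _ (hf i hi) _ (hf j hj)
  obtain ⟨h3, h4⟩ := hff i hi j hj
  have di := hD i hi
  have dj := hD j hj
  have t1 := wd_triR hgen (p' i) (p (f i)) (p' j)
  have t2 := wd_triR hgen (p (f i)) (p (f j)) (p' j)
  have t3 := wd_triR hgen (p (f i)) (p' i) (p (f j))
  have t4 := wd_triR hgen (p' i) (p' j) (p (f j))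
  rw [wd_comm hgen hsym (p (f j)) (p' j)] at t2
  rw [wd_comm hgen hsym (p (f i)) (p' i)] at t3
  have k0 : (0 : ℝ) < k := by linarith
  have kk : 1 / k ≤ 1 := by rw [div_le_one k0]; exact hk
  have k1 : 0 < 1 / k := by positivity
  have e1 : (1 / k) * |(i : ℝ) - j| ≤ (1 / k) * (|(f i : ℝ) - f j| + 2) := by gcongr
  have e2 : k * |(f i : ℝ) - f j| ≤ k * (|(i : ℝ) - j| + 2) := by gcongr
  constructor <;> linarith

lemma qg_ext (hgen : Generates π) (hsym : SymmetricGen π) {k c D : ℝ} (hk : 1 ≤ k)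
    {p : ℕ → G} {m : ℕ} (h : IsDiscreteQG π k c p m) (a b : G)
    (ha : (wordDist π a (p 0) : ℝ) ≤ D) (hb : (wordDist π b (p m) : ℝ) ≤ D) :
    ∃ p' : ℕ → G, p' 0 = a ∧ p' (m + 2) = b ∧ (∀ l ≤ m, p' (l + 1) = p l) ∧
      IsDiscreteQG π k (c + 2 * k + 2 * D) p' (m + 2) := by
  have hD : 0 ≤ D := (wd_nonneg _ _).trans ha
  refine ⟨fun l => if l = 0 then a else if l ≤ m + 1 then p (l - 1) else b, by simp, by simp,
    fun l hl => by simp [hl], ?_⟩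
  refine qg_reparam hgen hsym hk h (fun l => min (l - 1) m) (fun i _ => by simp) ?_ ?_
  · have key : ∀ i ≤ m + 2, ∀ j ≤ m + 2, i ≤ j →
      |((min (i - 1) m : ℕ) : ℝ) - (min (j - 1) m : ℕ)| ≤ |(i : ℝ) - j| + 2 ∧
      |(i : ℝ) - j| ≤ |((min (i - 1) m : ℕ) : ℝ) - (min (j - 1) m : ℕ)| + 2 := by
      intro i hi j hj hij
      have h1 : min (i - 1) m ≤ min (j - 1) m := by omega
      have h2 : min (j - 1) m + i ≤ j + 2 + min (i - 1) m := by omega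
      have h3 : j + min (i - 1) m ≤ min (j - 1) m + 2 + i := by omega
      rw [← natdist_cast, ← natdist_cast, Nat.dist_eq_sub_of_le h1, Nat.dist_eq_sub_of_le hij,
        Nat.cast_sub h1, Nat.cast_sub hij]
      have h2' : ((min (j - 1) m : ℕ) : ℝ) + i ≤ j + 2 + (min (i - 1) m : ℕ) := by exact_mod_cast h2
      have h3' : (j : ℝ) + (min (i - 1) m : ℕ) ≤ (min (j - 1) m : ℕ) + 2 + i := by exact_mod_cast h3
      constructor <;> linarith
    intro i hi j hj
    rcases le_total i j with hij | hij
    · exact key i hi j hj hij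
    · have := key j hj i hi hij
      rwa [abs_sub_comm, abs_sub_comm (j : ℝ)] at this
  · intro i hi
    by_cases h0 : i = 0
    · subst h0; simpa using ha
    by_cases h1 : i ≤ m + 1
    · simp [h0, h1, wd_self, hD]
    · have : i = m + 2 := by omega
      subst this
      simpa using hb

lemma mp_congr {M : MorseGauge} {q q' : ℕ → G} {n : ℕ} (h : IsMorsePath π M q n) (x : G)
    (hq : ∀ i ≤ n, q' i = x * q i) : IsMorsePath π M q' n := by
  intro k c hk hc p m hp i j hij hj h0 hm l hl
  have hp' : IsDiscreteQG π k c (fun t => x⁻¹ * p t) m := qg_congr hp x⁻¹ fun _ _ => rfl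
  obtain ⟨y, h1, h2, h3⟩ := h k c hk hc _ m hp' i j hij hj
    (by simp [h0, hq i (hij.trans hj)]) (by simp [hm, hq j hj]) l hl
  refine ⟨y, h1, h2, ?_⟩
  rw [hq y (h2.trans hj), ← wd_mul x⁻¹]
  simpa using h3

lemma mp_mono {M : MorseGauge} {q : ℕ → G} {n m : ℕ} (h : IsMorsePath π M q n) (hm : m ≤ n) :
    IsMorsePath π M q m := fun k c hk hc p m' hp i j hij hj =>
  h k c hk hc p m' hp i j hij (hj.trans hm)

lemma mp_shift {M : MorseGauge} {q : ℕ → G} {n : ℕ} (h : IsMorsePath π M q n) {i j : ℕ}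
    (hij : i ≤ j) (hj : j ≤ n) : IsMorsePath π M (fun t => q (i + t)) (j - i) := by
  intro k c hk hc p m hp a b hab hb h0 hm l hl
  obtain ⟨y, h1, h2, h3⟩ := h k c hk hc p m hp (i + a) (i + b) (by omega) (by omega) h0 hm l hl
  refine ⟨y - i, by omega, by omega, ?_⟩
  have : i + (y - i) = y := by omega
  simpa [this] using h3

/-- endpoints near a Morse path: ordered version -/
lemma near_ord (hgen : Generates π) (hsym : SymmetricGen π) {M : MorseGauge} {q : ℕ → G} {N : ℕ}
    (hq : IsMorsePath π M q N) {k c D : ℝ} (hk : 1 ≤ k) (hc : 0 ≤ c)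
    {p : ℕ → G} {m : ℕ} (hp : IsDiscreteQG π k c p m) {i j : ℕ} (hij : i ≤ j) (hj : j ≤ N)
    (h0 : (wordDist π (p 0) (q i) : ℝ) ≤ D) (hm : (wordDist π (p m) (q j) : ℝ) ≤ D) :
    ∀ l ≤ m, ∃ y, i ≤ y ∧ y ≤ j ∧
      (wordDist π (p l) (q y) : ℝ) ≤ M k (c + 2 * k + 2 * D) := by
  intro l hl
  rw [wd_comm hgen hsym] at h0 hm
  have hD : 0 ≤ D := (wd_nonneg _ _).trans h0
  obtain ⟨p', e0, em, e, hp'⟩ := qg_ext hgen hsym hk hp _ _ h0 hm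
  obtain ⟨y, h1, h2, h3⟩ := hq k _ hk (by linarith) p' _ hp' i j hij hj e0 em (l + 1) (by omega)
  rw [e l hl] at h3
  exact ⟨y, h1, h2, h3⟩

lemma near (hgen : Generates π) (hsym : SymmetricGen π) {M : MorseGauge} {q : ℕ → G} {N : ℕ}
    (hq : IsMorsePath π M q N) {k c D : ℝ} (hk : 1 ≤ k) (hc : 0 ≤ c)
    {p : ℕ → G} {m : ℕ} (hp : IsDiscreteQG π k c p m) {i j : ℕ} (hi : i ≤ N) (hj : j ≤ N)
    (h0 : (wordDist π (p 0) (q i) : ℝ) ≤ D) (hm : (wordDist π (p m) (q j) : ℝ) ≤ D) :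
    ∀ l ≤ m, ∃ y, min i j ≤ y ∧ y ≤ max i j ∧
      (wordDist π (p l) (q y) : ℝ) ≤ M k (c + 2 * k + 2 * D) := by
  intro l hl
  rcases le_total i j with hij | hij
  · rw [min_eq_left hij, max_eq_right hij]
    exact near_ord hgen hsym hq hk hc hp hij hj h0 hm l hl
  · rw [min_eq_right hij, max_eq_left hij]
    have := near_ord hgen hsym hq hk hc (qg_rev hp) hij hi (D := D) (by simpa using hm)
      (by simpa using h0) (m - l) (by omega)
    simpa [Nat.sub_sub_self hl] using this

/-- connectedness -/
lemma conn (hgen : Generates π) (hsym : SymmetricGen π) {q : ℕ → G} {N : ℕ} {k' c' D J : ℝ}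
    (hk' : 1 ≤ k') (hc' : 0 ≤ c') (hJ : 0 ≤ J) (hD : 0 ≤ D)
    (hq : IsDiscreteQG π k' c' q N) {p : ℕ → G} {m : ℕ}
    (hp : ∀ l < m, (wordDist π (p l) (p (l + 1)) : ℝ) ≤ J) {i j : ℕ} (hj : j ≤ N)
    (h0 : (wordDist π (p 0) (q i) : ℝ) ≤ D) (hm : (wordDist π (p m) (q j) : ℝ) ≤ D)
    (hn : ∀ l ≤ m, ∃ y, i ≤ y ∧ y ≤ j ∧ (wordDist π (p l) (q y) : ℝ) ≤ D) {y : ℕ}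
    (hiy : i ≤ y) (hyj : y ≤ j) :
    ∃ l ≤ m, (wordDist π (q y) (p l) : ℝ) ≤ k' * (k' * (2 * D + J + c')) + c' + D := by
  have k0 : (0 : ℝ) < k' := by linarith
  have gap : ∀ a b : ℕ, a ≤ b → b ≤ j → (wordDist π (q a) (q b) : ℝ) ≤ 2 * D + J →
      (b : ℝ) - a ≤ k' * (2 * D + J + c') := by
    intro a b hab hb h
    have h1 := (hq a (by omega) b (by omega)).1
    rw [abs_sub_comm, abs_of_nonneg (by simpa using hab)] at h1
    have h2 : (1 / k') * ((b : ℝ) - a) ≤ 2 * D + J + c' := by linarith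
    calc (b : ℝ) - a = k' * ((1 / k') * ((b : ℝ) - a)) := by field_simp
      _ ≤ _ := by gcongr
  have fin : ∀ l ≤ m, ∀ f, y ≤ f → f ≤ j → (wordDist π (p l) (q f) : ℝ) ≤ D →
      (f : ℝ) - y ≤ k' * (2 * D + J + c') →
      ∃ l ≤ m, (wordDist π (q y) (p l) : ℝ) ≤ k' * (k' * (2 * D + J + c')) + c' + D := by
    intro l hl f hyf hf hd hg
    refine ⟨l, hl, ?_⟩
    have h1 := (hq y (by omega) f (by omega)).2
    rw [abs_sub_comm, abs_of_nonneg (by simpa using hyf)] at h1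
    have h2 := wd_triR hgen (q y) (q f) (p l)
    rw [wd_comm hgen hsym (q f)] at h2
    have h3 : k' * ((f : ℝ) - y) ≤ k' * (k' * (2 * D + J + c')) := by gcongr
    linarith
  have ex : ∃ l, l ≤ m ∧ ∃ f, y ≤ f ∧ f ≤ j ∧ (wordDist π (p l) (q f) : ℝ) ≤ D :=
    ⟨m, le_rfl, j, hyj, le_rfl, hm⟩
  obtain ⟨hl, f, hyf, hfj, hd⟩ := Nat.find_spec ex
  have hmin := fun l => Nat.find_min (m := l) ex
  generalize Nat.find ex = l at *
  cases l with
  | zero =>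
    refine fin 0 hl f hyf hfj hd ?_
    have h2 := wd_triR hgen (q i) (p 0) (q f)
    rw [wd_comm hgen hsym (q i) (p 0)] at h2
    have h3 := gap i f (by omega) hfj (by linarith)
    have : (i : ℝ) ≤ y := by exact_mod_cast hiy
    linarith
  | succ l =>
    refine fin (l + 1) hl f hyf hfj hd ?_
    obtain ⟨a, ha, haj, had⟩ := hn l (by omega)
    have hay : a < y := by
      by_contra hcon
      exact hmin l (by omega) ⟨by omega, a, by omega, haj, had⟩
    have h2 := wd_triR hgen (q a) (p l) (q f)
    have h3 := wd_triR hgen (p l) (p (l + 1)) (q f)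
    have h4 := hp l (by omega)
    rw [wd_comm hgen hsym (q a) (p l)] at h2
    have h5 := gap a f (by omega) hfj (by linarith)
    have : (a : ℝ) ≤ y := by exact_mod_cast hay.le
    linarith

/-- the constant in `near2` -/
noncomputable def nearConst (M : MorseGauge) (k' c' k c D : ℝ) : ℝ :=
  let D1 := max D (M k (c + 2 * k + 2 * D))
  k' * (k' * (2 * D1 + (k + c) + c')) + c' + D1

lemma near2_ord (hgen : Generates π) (hsym : SymmetricGen π) {M : MorseGauge} {q : ℕ → G} {N : ℕ}
    (hq : IsMorsePath π M q N) {k' c' : ℝ} (hk' : 1 ≤ k') (hc' : 0 ≤ c')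
    (hqq : IsDiscreteQG π k' c' q N)
    {k c D : ℝ} (hk : 1 ≤ k) (hc : 0 ≤ c)
    {p : ℕ → G} {m : ℕ} (hp : IsDiscreteQG π k c p m) {i j : ℕ} (hij : i ≤ j) (hj : j ≤ N)
    (h0 : (wordDist π (p 0) (q i) : ℝ) ≤ D) (hm : (wordDist π (p m) (q j) : ℝ) ≤ D) :
    ∀ y, i ≤ y → y ≤ j → ∃ l ≤ m,
      (wordDist π (q y) (p l) : ℝ) ≤ nearConst M k' c' k c D := by
  intro y hiy hyj
  have hD : 0 ≤ D := (wd_nonneg _ _).trans h0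
  refine conn hgen hsym hk' hc' (by linarith) (le_max_of_le_left hD) hqq ?_ hj
    (le_max_of_le_left h0) (le_max_of_le_left hm) ?_ hiy hyj
  · intro l hl
    have := (hp l hl.le (l + 1) hl).2
    simpa using this
  · intro l hl
    obtain ⟨y, h1, h2, h3⟩ := near_ord hgen hsym hq hk hc hp hij hj h0 hm l hl
    exact ⟨y, h1, h2, le_max_of_le_right h3⟩

lemma near2 (hgen : Generates π) (hsym : SymmetricGen π) {M : MorseGauge} {q : ℕ → G} {N : ℕ}
    (hq : IsMorsePath π M q N) {k' c' : ℝ} (hk' : 1 ≤ k') (hc' : 0 ≤ c')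
    (hqq : IsDiscreteQG π k' c' q N)
    {k c D : ℝ} (hk : 1 ≤ k) (hc : 0 ≤ c)
    {p : ℕ → G} {m : ℕ} (hp : IsDiscreteQG π k c p m) {i j : ℕ} (hi : i ≤ N) (hj : j ≤ N)
    (h0 : (wordDist π (p 0) (q i) : ℝ) ≤ D) (hm : (wordDist π (p m) (q j) : ℝ) ≤ D) :
    ∀ y, min i j ≤ y → y ≤ max i j → ∃ l ≤ m,
      (wordDist π (q y) (p l) : ℝ) ≤ nearConst M k' c' k c D := by
  intro y
  rcases le_total i j with hij | hij
  · rw [min_eq_left hij, max_eq_right hij]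
    exact near2_ord hgen hsym hq hk' hc' hqq hk hc hp hij hj h0 hm y
  · rw [min_eq_right hij, max_eq_left hij]
    intro h1 h2
    obtain ⟨l, hl, h⟩ := near2_ord hgen hsym hq hk' hc' hqq hk hc (qg_rev hp) hij hi (D := D)
      (by simpa using hm) (by simpa using h0) y h1 h2
    exact ⟨m - l, by omega, h⟩

/-- gauge of a geodesic fellow-travelling a Morse quasi-geodesic -/
noncomputable def nearGauge (M : MorseGauge) (k' c' D : ℝ) : MorseGauge :=
  fun k c => M k (c + 2 * k + 2 * D) + nearConst M k' c' 1 0 D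

lemma morse_of_near (hgen : Generates π) (hsym : SymmetricGen π) {M : MorseGauge} {q : ℕ → G}
    {N : ℕ} (hq : IsMorsePath π M q N) {k' c' : ℝ} (hk' : 1 ≤ k') (hc' : 0 ≤ c')
    (hqq : IsDiscreteQG π k' c' q N) {D : ℝ} {σ : ℕ → G} {n : ℕ}
    (hσ : IsDiscreteQG π 1 0 σ n)
    (hn : ∀ l ≤ n, ∃ y ≤ N, (wordDist π (σ l) (q y) : ℝ) ≤ D) :
    IsMorsePath π (nearGauge M k' c' D) σ n := by
  intro k c hk hc p m hp i j hij hj h0 hm l hl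
  obtain ⟨a, ha, had⟩ := hn i (hij.trans hj)
  obtain ⟨b, hb, hbd⟩ := hn j hj
  obtain ⟨y, h1, h2, h3⟩ := near hgen hsym hq hk hc hp ha hb (D := D) (by rwa [h0]) (by rwa [hm]) l hl
  obtain ⟨t, ht, h4⟩ := near2 hgen hsym hq hk' hc' hqq le_rfl le_rfl (qg_shift hσ hij hj) ha hb
    (by simpa using had) (by simpa [Nat.add_sub_cancel' hij] using hbd) y h1 h2
  refine ⟨i + t, by omega, by omega, ?_⟩
  have := wd_triR hgen (p l) (q y) (σ (i + t))
  unfold nearGauge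
  linarith

end morse
section axis
variable {G : Type} [Group G] {A : Type} {π : A → G}

/-- data of a Morse quasi-axis -/
structure Ax (π : A → G) (M : MorseGauge) (k c : ℝ) (s P : ℕ) (g : G) (q : ℕ → G) : Prop where
  hk : 1 ≤ k
  hc : 0 ≤ c
  hP : 1 ≤ P
  q0 : q 0 = 1
  qg : ∀ N, IsDiscreteQG π k c q N
  mp : ∀ N, IsMorsePath π M q N
  ne : ∀ n, wordDist π (g ^ n) (q (s + n * P)) ≤ s
  cob : ∃ C : ℕ, ∀ i, ∃ n : ℕ, wordDist π (q i) (g ^ n) ≤ C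

variable {M : MorseGauge} {k c : ℝ} {s P : ℕ} {g : G} {q : ℕ → G}

/-- nearness constant -/
noncomputable def axD (M : MorseGauge) (s : ℕ) : ℝ := M 1 (0 + 2 * 1 + 2 * (s : ℝ))

lemma Ax.near1 (hgen : Generates π) (hsym : SymmetricGen π) (h : Ax π M k c s P g q)
    {σ : ℕ → G} {m n : ℕ} (hσ : IsDiscreteQG π 1 0 σ m)
    (he : (σ 0 = 1 ∧ σ m = g ^ n) ∨ (σ 0 = g ^ n ∧ σ m = 1)) :
    ∀ l ≤ m, ∃ y ≤ s + n * P, (wordDist π (σ l) (q y) : ℝ) ≤ axD M s := by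
  intro l hl
  have hn : (wordDist π (g ^ n) (q (s + n * P)) : ℝ) ≤ s := by exact_mod_cast h.ne n
  have h1 : (wordDist π 1 (q 0) : ℝ) ≤ s := by rw [h.q0, wd_self]; simp
  rcases he with ⟨e1, e2⟩ | ⟨e1, e2⟩
  · obtain ⟨y, _, h2, h3⟩ := near hgen hsym (h.mp (s + n * P)) le_rfl le_rfl hσ
      (Nat.zero_le _) le_rfl (D := s) (by rwa [e1]) (by rwa [e2]) l hl
    exact ⟨y, by simpa using h2, h3⟩
  · obtain ⟨y, _, h2, h3⟩ := near hgen hsym (h.mp (s + n * P)) le_rfl le_rfl hσ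
      le_rfl (Nat.zero_le _) (D := s) (by rwa [e1]) (by rwa [e2]) l hl
    exact ⟨y, by simpa using h2, h3⟩

lemma Ax.morse1 (hgen : Generates π) (hsym : SymmetricGen π) (h : Ax π M k c s P g q)
    {σ : ℕ → G} {m n : ℕ} (hσ : IsDiscreteQG π 1 0 σ m)
    (he : (σ 0 = 1 ∧ σ m = g ^ n) ∨ (σ 0 = g ^ n ∧ σ m = 1)) :
    IsMorsePath π (nearGauge M k c (axD M s)) σ m :=
  morse_of_near hgen hsym (h.mp (s + n * P)) h.hk h.hc (h.qg _) hσ (h.near1 hgen hsym hσ he)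

lemma Ax.near_pow (hgen : Generates π) (hsym : SymmetricGen π) (h : Ax π M k c s P g q)
    (p : ℕ) (hp : 1 ≤ p) : ∃ C : ℕ, ∀ {σ : ℕ → G} {m n : ℕ}, IsDiscreteQG π 1 0 σ m →
    ((σ 0 = 1 ∧ σ m = g ^ n) ∨ (σ 0 = g ^ n ∧ σ m = 1)) → ∀ l ≤ m, ∃ a : ℕ,
      wordDist π (σ l) ((g ^ p) ^ a) ≤ C := by
  obtain ⟨C, hC⟩ := h.cob
  let S := (Finset.range p).sup fun r => wordLength π (g ^ r)
  refine ⟨⌈axD M s⌉₊ + C + S, ?_⟩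
  intro σ m n hσ he l hl
  obtain ⟨y, -, hy⟩ := h.near1 hgen hsym hσ he l hl
  have hy' : wordDist π (σ l) (q y) ≤ ⌈axD M s⌉₊ := by
    exact_mod_cast hy.trans (Nat.le_ceil _)
  obtain ⟨b, hb⟩ := hC y
  refine ⟨b / p, ?_⟩
  have h1 := wd_tri hgen (σ l) (q y) (g ^ b)
  have h2 := wd_tri hgen (σ l) (g ^ b) ((g ^ p) ^ (b / p))
  have h3 : wordDist π (g ^ b) ((g ^ p) ^ (b / p)) ≤ S := by
    rw [wd_comm hgen hsym]
    have e : g ^ b = (g ^ p) ^ (b / p) * g ^ (b % p) := by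
      rw [← pow_mul, ← pow_add, Nat.div_add_mod]
    rw [wordDist, e, inv_mul_cancel_left]
    exact Finset.le_sup (f := fun r => wordLength π (g ^ r))
      (Finset.mem_range.2 (Nat.mod_lt _ hp))
  omega

lemma Ax.morseElement (hgen : Generates π) (hsym : SymmetricGen π) (h : Ax π M k c s P g q)
    (p : ℕ) (hp : 1 ≤ p) : IsMorseElement π (g ^ p) := by
  obtain ⟨C, hC⟩ := h.near_pow hgen hsym p hp
  refine ⟨nearGauge M k c (axD M s), C, ?_⟩
  rintro x hx w hw hgw
  obtain ⟨z, rfl⟩ := Subgroup.mem_zpowers_iff.1 hx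
  have geo := geo_wordPath hgen hsym hgw
  obtain ⟨n, rfl | rfl⟩ := z.eq_nat_or_neg
  · have he : wordPath π w w.length = g ^ (p * n) := by
      rw [wordPath_len, hw, zpow_natCast, pow_mul]
    refine ⟨h.morse1 hgen hsym geo (.inl ⟨wordPath_zero w, he⟩), fun i hi => ?_⟩
    obtain ⟨a, ha⟩ := hC geo (.inl ⟨wordPath_zero w, he⟩) i hi
    exact ⟨_, Subgroup.npow_mem_zpowers _ a, ha⟩
  · have he : g ^ (p * n) * wordPath π w w.length = 1 := by
      rw [wordPath_len, hw, zpow_neg, zpow_natCast, pow_mul]; group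
    have geo' : IsDiscreteQG π 1 0 (fun t => g ^ (p * n) * wordPath π w t) w.length :=
      qg_congr geo _ fun _ _ => rfl
    refine ⟨mp_congr (h.morse1 hgen hsym (n := p * n) geo' (.inr ⟨by simp [wordPath_zero], he⟩))
      (g ^ (p * n))⁻¹ fun i _ => by simp, fun i hi => ?_⟩
    obtain ⟨a, ha⟩ := hC (n := p * n) geo' (.inr ⟨by simp [wordPath_zero], he⟩) i hi
    refine ⟨(g ^ (p * n))⁻¹ * (g ^ p) ^ a, ?_, ?_⟩
    · rw [pow_mul]
      exact mul_mem (inv_mem (Subgroup.npow_mem_zpowers _ n)) (Subgroup.npow_mem_zpowers _ a)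
    · rw [← wd_mul (g ^ (p * n))]
      simpa using ha

lemma Ax.grow (hgen : Generates π) (h : Ax π M k c s P g q) (R : ℕ) :
    ∃ i0, ∀ i ≥ i0, R < wordDist π 1 (g ^ i) := by
  refine ⟨⌈k * (R + c + s + 1)⌉₊, fun i hi => ?_⟩
  have hi' : k * (R + c + s + 1) ≤ i := (Nat.le_ceil _).trans (by exact_mod_cast hi)
  have k0 : 0 < k := by linarith [h.hk]
  have h1 := (h.qg (s + i * P) 0 (Nat.zero_le _) (s + i * P) le_rfl).1
  have h2 := wd_triR hgen 1 (g ^ i) (q (s + i * P))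
  have h3 : (wordDist π (g ^ i) (q (s + i * P)) : ℝ) ≤ s := by exact_mod_cast h.ne i
  rw [h.q0, abs_sub_comm, Nat.cast_zero, sub_zero, abs_of_nonneg (Nat.cast_nonneg _)] at h1
  have h4 : (i : ℝ) ≤ (s + i * P : ℕ) := by
    have := Nat.le_mul_of_pos_right i h.hP
    exact_mod_cast (by omega)
  have h5 : (1 / k) * (k * (R + c + s + 1)) ≤ (1 / k) * ((s + i * P : ℕ) : ℝ) := by
    gcongr; linarith
  have h6 : (1 / k) * (k * (R + c + s + 1)) = R + c + s + 1 := by field_simp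
  have : (R : ℝ) < wordDist π 1 (g ^ i) := by linarith
  exact_mod_cast this

lemma qg3_of (hgen : Generates π) (hsym : SymmetricGen π) {p : ℕ → G} {n : ℕ}
    (h : ∀ i j, i ≤ j → j ≤ n → wordDist π (p i) (p j) ≤ j - i ∧
      j - i ≤ 3 * wordDist π (p i) (p j)) : IsDiscreteQG π 3 0 p n := by
  have key : ∀ i j, i ≤ j → j ≤ n →
    (1 / 3) * |(i : ℝ) - (j : ℝ)| - 0 ≤ (wordDist π (p i) (p j) : ℝ) ∧
    (wordDist π (p i) (p j) : ℝ) ≤ 3 * |(i : ℝ) - (j : ℝ)| + 0 := by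
    intro i j hij hj
    obtain ⟨h1, h2⟩ := h i j hij hj
    rw [← natdist_cast, Nat.dist_eq_sub_of_le hij]
    have h1' : (wordDist π (p i) (p j) : ℝ) ≤ (j - i : ℕ) := by exact_mod_cast h1
    have h2' : ((j - i : ℕ) : ℝ) ≤ 3 * (wordDist π (p i) (p j) : ℝ) := by exact_mod_cast h2
    have := wd_nonneg (π := π) (p i) (p j)
    constructor <;> linarith
  intro i hi j hj
  rcases le_total i j with hij | hij
  · exact key i j hij hj
  · rw [abs_sub_comm, wd_comm hgen hsym]; exact key j i hij hi

/-- projecting a point to a geodesic gives a (3,0)-quasi-geodesic -/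
lemma exists_proj (hgen : Generates π) (hsym : SymmetricGen π) {τ : ℕ → G} {T : ℕ}
    (hτ : IsDiscreteQG π 1 0 τ T) (o : G) :
    ∃ (p : ℕ → G) (m a l0 : ℕ), a ≤ wordDist π o (τ 0) ∧ l0 ≤ T ∧ m = a + (T - l0) ∧
      p 0 = o ∧ p m = τ T ∧ (∀ l ≤ a, wordDist π o (p l) ≤ l) ∧
      (∀ l, a < l → p l = τ (l0 + (l - a))) ∧ IsDiscreteQG π 3 0 p m := by
  obtain ⟨l0, hl0, hmin⟩ := Finset.exists_min_image (Finset.range (T + 1))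
    (fun l => wordDist π o (τ l)) ⟨0, by simp⟩
  have hl0 : l0 ≤ T := by simpa [Nat.lt_succ_iff] using hl0
  have hmin : ∀ l ≤ T, wordDist π o (τ l0) ≤ wordDist π o (τ l) := fun l hl =>
    hmin l (by simpa [Nat.lt_succ_iff] using hl)
  obtain ⟨ρ, r0, ra, hρ⟩ := exists_geo hgen hsym o (τ l0)
  have ha : wordDist π o (τ l0) ≤ wordDist π o (τ 0) := hmin 0 (Nat.zero_le _)
  generalize hae : wordDist π o (τ l0) = a at *
  have ptau : ∀ l, a ≤ l → (if l ≤ a then ρ l else τ (l0 + (l - a))) = τ (l0 + (l - a)) := by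
    intro l hl
    split_ifs with h
    · have : l = a := le_antisymm h hl
      subst this; simp [ra]
    · rfl
  have prho : ∀ l, l ≤ a → (if l ≤ a then ρ l else τ (l0 + (l - a))) = ρ l := by
    intro l hl; simp [hl]
  refine ⟨fun l => if l ≤ a then ρ l else τ (l0 + (l - a)), a + (T - l0), a, l0, ha, hl0, rfl,
    by simp [r0], ?_, ?_, ?_, ?_⟩
  · simp only
    rw [ptau _ (by omega)]; congr 1; omega
  · intro l hl
    simp only
    rw [prho l hl, ← r0, geo_dist hρ (Nat.zero_le _) hl]; simp
  · intro l hl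
    simp only
    exact ptau l hl.le
  · refine qg3_of hgen hsym fun i j hij hj => ?_
    by_cases hja : j ≤ a
    · rw [prho i (by omega), prho j hja, geo_dist hρ hij hja]; omega
    by_cases hia : a ≤ i
    · rw [ptau i hia, ptau j (by omega), geo_dist hτ (by omega) (by omega)]; omega
    rw [prho i (by omega), ptau j (by omega)]
    have h1 := geo_dist hρ (i := i) (j := a) (by omega) le_rfl
    have h2 := geo_dist hρ (i := 0) (j := i) (by omega) (by omega)
    have h3 := geo_dist hτ (i := l0) (j := l0 + (j - a)) (by omega) (by omega)
    have h4 := hmin (l0 + (j - a)) (by omega)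
    rw [r0] at h2
    rw [ra] at h1
    have t1 := wd_tri hgen (ρ i) (τ l0) (τ (l0 + (j - a)))
    have t2 := wd_tri hgen o (ρ i) (τ (l0 + (j - a)))
    have t3 := wd_tri hgen (τ l0) (ρ i) (τ (l0 + (j - a)))
    rw [wd_comm hgen hsym (τ l0) (ρ i)] at t3
    omega

lemma Ax.star (hgen : Generates π) (hsym : SymmetricGen π) (h : Ax π M k c s P g q) :
    ∃ K : ℕ, ∀ v, ∃ i0, ∀ i ≥ i0, ∀ n ≥ i, ∃ b, wordLength π b ≤ K ∧
      wordDist π v (g ^ n) = wordDist π v (g ^ i * b) + wordDist π (g ^ i * b) (g ^ n) := by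
  refine ⟨⌈nearConst M k c 3 0 s⌉₊ + s, fun v => ?_⟩
  obtain ⟨i0, hi0⟩ := h.grow hgen (wordDist π 1 v + (⌈nearConst M k c 3 0 s⌉₊ + s))
  refine ⟨i0, fun i hi n hn => ?_⟩
  have hgi := hi0 i hi
  obtain ⟨τ, t0, t1, hτ⟩ := exists_geo hgen hsym v (g ^ n)
  generalize hT : wordDist π v (g ^ n) = T at *
  obtain ⟨p, m, a, l0, ha, hl0, hm, p0, pm, hpa, hpt, hp⟩ := exists_proj hgen hsym hτ 1
  have hn' : (wordDist π (p m) (q (s + n * P)) : ℝ) ≤ s := by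
    rw [pm, t1]; exact_mod_cast h.ne n
  have h1 : (wordDist π (p 0) (q 0) : ℝ) ≤ s := by rw [h.q0, p0, wd_self]; simp
  obtain ⟨l, hl, hd⟩ := near2_ord hgen hsym (h.mp (s + n * P)) h.hk h.hc (h.qg _) (by norm_num)
    le_rfl hp (Nat.zero_le _) le_rfl h1 hn' (s + i * P) (Nat.zero_le _)
    (by have := Nat.mul_le_mul_right P hn; omega)
  have hd' : wordDist π (q (s + i * P)) (p l) ≤ ⌈nearConst M k c 3 0 s⌉₊ := by
    exact_mod_cast hd.trans (Nat.le_ceil _)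
  have h2 := wd_tri hgen (g ^ i) (q (s + i * P)) (p l)
  have h3 := h.ne i
  by_cases hla : l ≤ a
  · exfalso
    have h4 := hpa l hla
    have h5 := wd_tri hgen 1 (p l) (g ^ i)
    rw [wd_comm hgen hsym (p l)] at h5
    rw [t0] at ha
    omega
  · have e := hpt l (by omega)
    refine ⟨(g ^ i)⁻¹ * p l, ?_, ?_⟩
    · change wordDist π (g ^ i) (p l) ≤ _
      omega
    · rw [mul_inv_cancel_left, e]
      have h6 := geo_dist hτ (i := 0) (j := l0 + (l - a)) (by omega) (by omega)
      have h7 := geo_dist hτ (i := l0 + (l - a)) (j := T) (by omega) (by omega)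
      rw [t0] at h6; rw [t1] at h7
      omega

lemma Ax.period [Fintype A] (hgen : Generates π) (hsym : SymmetricGen π)
    (h : Ax π M k c s P g q) :
    ∃ p : ℕ, 1 ≤ p ∧ ∃ C : ℤ, ∀ v, ∃ n0, ∀ n ≥ n0,
      (wordDist π v (g ^ (n + p)) : ℤ) = wordDist π v (g ^ n) + C := by
  obtain ⟨K, hK⟩ := h.star hgen hsym
  have fin : Finite {b : G // wordLength π b ≤ K} := (ball_finite hgen K).to_subtype
  have bd : ∀ (n : ℕ) (b : {b : G // wordLength π b ≤ K}),
      (wordDist π b.1 (g ^ n) : ℤ) - wordDist π 1 (g ^ n) ∈ Set.Icc (-(K : ℤ)) K := by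
    intro n b
    have hb := b.2
    have h1 := wd_tri hgen b.1 1 (g ^ n)
    have h2 := wd_tri hgen 1 b.1 (g ^ n)
    rw [wd_comm hgen hsym b.1 1] at h1
    rw [wd_one b.1] at h1 h2
    constructor <;> omega
  obtain ⟨m, m', hne, heq⟩ := Finite.exists_ne_map_eq_of_infinite
    (fun (n : ℕ) (b : {b : G // wordLength π b ≤ K}) =>
      (⟨_, bd n b⟩ : Set.Icc (-(K : ℤ)) K))
  wlog hlt : m < m' generalizing m m'
  · exact this m' m hne.symm heq.symm (by omega)
  have hval : ∀ b, wordLength π b ≤ K → (wordDist π b (g ^ m') : ℤ) =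
      wordDist π b (g ^ m) + (wordDist π 1 (g ^ m') - wordDist π 1 (g ^ m)) := by
    intro b hb
    have := congrArg Subtype.val (congrFun heq ⟨b, hb⟩)
    simp only at this
    linarith
  refine ⟨m' - m, by omega, wordDist π 1 (g ^ m') - wordDist π 1 (g ^ m), fun v => ?_⟩
  obtain ⟨i0, hi0⟩ := hK v
  refine ⟨i0 + m, fun n hn => ?_⟩
  obtain ⟨i, rfl⟩ : ∃ i, n = i + m := ⟨n - m, by omega⟩
  have e : i + m + (m' - m) = i + m' := by omega
  rw [e]
  have tr : ∀ b r, wordDist π (g ^ i * b) (g ^ (i + r)) = wordDist π b (g ^ r) := by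
    intro b r; rw [pow_add, wd_mul]
  obtain ⟨b, hb, h1⟩ := hi0 i (by omega) (i + m) (by omega)
  obtain ⟨b', hb', h2⟩ := hi0 i (by omega) (i + m') (by omega)
  have h3 := wd_tri hgen v (g ^ i * b) (g ^ (i + m'))
  have h4 := wd_tri hgen v (g ^ i * b') (g ^ (i + m))
  rw [tr] at h1 h2 h3 h4
  have h5 := hval b hb
  have h6 := hval b' hb'
  omega

end axis
section rays
variable {G : Type} [Group G] {A : Type} {π : A → G}

lemma ray_of_conv [Fintype A] (hgen : Generates π) (hsym : SymmetricGen π) (h : G)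
    (hinf : ∀ R : ℕ, ∃ n0, ∀ n ≥ n0, R < wordDist π 1 (h ^ n))
    (hconv : ∀ v, ∃ e : ℤ, ∃ n0, ∀ n ≥ n0,
      (wordDist π v (h ^ n) : ℤ) = wordDist π 1 (h ^ n) + e) :
    ∃ (γ : ℕ → G) (w : ℕ → List A), IsRay π γ ∧
      (∀ n, IsGeodesicWord π (w n) ∧ wordEval π (w n) = h ^ n) ∧ ConvergesTo π w γ := by
  let T : List A → Prop := fun u => ∃ n0, ∀ n ≥ n0,
    u.length + wordDist π (wordEval π u) (h ^ n) = wordDist π 1 (h ^ n)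
  have T0 : T [] := ⟨0, fun n _ => by simp [wordEval_nil]⟩
  have Ts : ∀ u, T u → ∃ a, T (u ++ [a]) := by
    rintro u ⟨n0, hn0⟩
    choose e na hna using fun a : A => hconv (wordEval π (u ++ [a]))
    obtain ⟨n1, hn1⟩ := hinf u.length
    let n := max n0 (max n1 (Finset.univ.sup na))
    have e1 := hn0 n (le_max_left _ _)
    have e2 := hn1 n ((le_max_left _ _).trans (le_max_right _ _))
    obtain ⟨z, hz, hz'⟩ := exists_geod hgen ((wordEval π u)⁻¹ * h ^ n)
    have hz'' : z.length = wordDist π (wordEval π u) (h ^ n) := hz'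
    cases z with
    | nil => simp at hz''; omega
    | cons a z =>
      have h3 : wordEval π z = (wordEval π (u ++ [a]))⁻¹ * h ^ n := by
        have : wordEval π (a :: z) = π a * wordEval π z := by simp [wordEval]
        have h4 : wordEval π (u ++ [a]) = wordEval π u * π a := by simp [wordEval]
        rw [h4, mul_inv_rev, mul_assoc, ← hz, this]; group
      have h5 : wordDist π (wordEval π (u ++ [a])) (h ^ n) ≤ z.length := by
        rw [wordDist, ← h3]; exact wordLength_le z
      have h6 := wd_tri hgen 1 (wordEval π (u ++ [a])) (h ^ n)
      have h7 : wordDist π 1 (wordEval π (u ++ [a])) ≤ u.length + 1 := by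
        rw [wd_one]; simpa using wordLength_le (π := π) (u ++ [a])
      simp only [List.length_cons] at hz''
      have hle : na a ≤ n := (Finset.le_sup (Finset.mem_univ a)).trans
        ((le_max_right _ _).trans (le_max_right _ _))
      have h8 := hna a n hle
      refine ⟨a, na a, fun n' hn' => ?_⟩
      have h9 := hna a n' hn'
      simp only [List.length_append, List.length_cons, List.length_nil]
      omega
  choose nx hnx using Ts
  let U : ℕ → {u // T u} := fun m =>
    Nat.rec ⟨[], T0⟩ (fun _ u => ⟨u.1 ++ [nx u.1 u.2], hnx u.1 u.2⟩) m
  have Usucc : ∀ m, (U (m + 1)).1 = (U m).1 ++ [nx (U m).1 (U m).2] := fun m => rfl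
  have Ulen : ∀ m, (U m).1.length = m := by
    intro m
    induction m with
    | zero => rfl
    | succ m ih => rw [Usucc]; simp [ih]
  have Utake : ∀ t d, (U (t + d)).1.take t = (U t).1 := by
    intro t d
    induction d with
    | zero => rw [Nat.add_zero, List.take_of_length_le (Ulen t).le]
    | succ d ih =>
      rw [← Nat.add_assoc, Usucc, List.take_append_of_le_length (by rw [Ulen]; omega), ih]
  let γ : ℕ → G := fun m => wordEval π (U m).1
  have good : ∀ m, ∃ n0, ∀ n ≥ n0, m + wordDist π (γ m) (h ^ n) = wordDist π 1 (h ^ n) := by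
    intro m
    obtain ⟨n0, hn0⟩ := (U m).2
    rw [Ulen] at hn0
    exact ⟨n0, hn0⟩
  let mm : ℕ → ℕ := fun n =>
    Nat.findGreatest (fun m => m + wordDist π (γ m) (h ^ n) = wordDist π 1 (h ^ n)) n
  have hmm : ∀ n, mm n + wordDist π (γ (mm n)) (h ^ n) = wordDist π 1 (h ^ n) := by
    intro n
    have h00 : 0 + wordDist π (γ 0) (h ^ n) = wordDist π 1 (h ^ n) := by
      have : γ 0 = 1 := wordEval_nil
      rw [this, zero_add]
    exact Nat.findGreatest_spec
      (P := fun m => m + wordDist π (γ m) (h ^ n) = wordDist π 1 (h ^ n)) (Nat.zero_le n) h00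
  choose z hz hz' using fun n => exists_geod hgen ((γ (mm n))⁻¹ * h ^ n)
  have hw : ∀ n, IsGeodesicWord π ((U (mm n)).1 ++ z n) ∧
      wordEval π ((U (mm n)).1 ++ z n) = h ^ n := by
    intro n
    have e : wordEval π ((U (mm n)).1 ++ z n) = h ^ n := by
      rw [wordEval_append, hz]; simp [γ]
    refine ⟨?_, e⟩
    rw [IsGeodesicWord, e, List.length_append, Ulen, hz', ← wd_one (h ^ n)]
    exact hmm n
  have hcv : ConvergesTo π (fun n => (U (mm n)).1 ++ z n) γ := by
    intro m
    obtain ⟨n0, hn0⟩ := good m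
    refine ⟨max n0 m, fun n hn => ?_⟩
    have hle : m ≤ mm n := Nat.le_findGreatest ((le_max_right _ _).trans hn)
      (hn0 n ((le_max_left _ _).trans hn))
    refine ⟨by rw [List.length_append, Ulen]; omega, fun t ht => ?_⟩
    rw [wordPath, List.take_append_of_le_length (by rw [Ulen]; omega)]
    obtain ⟨d, hd⟩ := Nat.exists_eq_add_of_le (ht.trans hle)
    rw [hd, Utake]
  refine ⟨γ, fun n => (U (mm n)).1 ++ z n, ⟨wordEval_nil, fun i j => ?_⟩, hw, hcv⟩
  obtain ⟨n0, hn0⟩ := hcv (max i j)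
  obtain ⟨h1, h2⟩ := hn0 n0 le_rfl
  have := (geo_iff _ _).1 (geo_wordPath hgen hsym (hw n0).1) i ((le_max_left _ _).trans h1) j
    ((le_max_right _ _).trans h1)
  rwa [h2 i (le_max_left _ _), h2 j (le_max_right _ _)] at this

lemma Ax.plus [Fintype A] (hgen : Generates π) (hsym : SymmetricGen π)
    {M : MorseGauge} {k c : ℝ} {s P : ℕ} {g : G} {q : ℕ → G} (h : Ax π M k c s P g q) :
    ∃ (g' : G) (γ : ℕ → G) (hγ : IsMorseRay π (nearGauge M k c (axD M s)) γ),
      IsMorseElement π g' ∧ IsPlusPoint π g' (mkBoundary π γ _ hγ) ∧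
      ∀ t, wordDist π 1 (q t) = t →
        wordDist π (q t) (γ t) ≤ 2 * ⌈nearConst M k c 1 0 s⌉₊ := by
  obtain ⟨p, hp, C, hC⟩ := h.period hgen hsym
  have hinf : ∀ R : ℕ, ∃ n0, ∀ n ≥ n0, R < wordDist π 1 ((g ^ p) ^ n) := by
    intro R
    obtain ⟨i0, hi0⟩ := h.grow hgen R
    refine ⟨i0, fun n hn => ?_⟩
    rw [← pow_mul]
    exact hi0 _ (hn.trans (Nat.le_mul_of_pos_left n hp))
  have step : ∀ v, ∃ n0, ∀ n ≥ n0,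
      (wordDist π v ((g ^ p) ^ (n + 1)) : ℤ) = wordDist π v ((g ^ p) ^ n) + C := by
    intro v
    obtain ⟨n0, hn0⟩ := hC v
    refine ⟨n0, fun n hn => ?_⟩
    rw [← pow_mul, ← pow_mul, Nat.mul_succ]
    exact hn0 _ (hn.trans (Nat.le_mul_of_pos_left n hp))
  have hconv : ∀ v, ∃ e : ℤ, ∃ n0, ∀ n ≥ n0,
      (wordDist π v ((g ^ p) ^ n) : ℤ) = wordDist π 1 ((g ^ p) ^ n) + e := by
    intro v
    obtain ⟨a, ha⟩ := step v
    obtain ⟨b, hb⟩ := step 1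
    refine ⟨wordDist π v ((g ^ p) ^ (max a b)) - wordDist π 1 ((g ^ p) ^ (max a b)), max a b,
      fun n hn => ?_⟩
    induction n, hn using Nat.le_induction with
    | base => ring
    | succ n hn ih =>
      rw [ha n (by omega), hb n (by omega), ih]; ring
  obtain ⟨γ, w, hray, hw, hcv⟩ := ray_of_conv hgen hsym (g ^ p) hinf hconv
  have hend : ∀ n, wordPath π (w n) (w n).length = g ^ (p * n) := by
    intro n; rw [wordPath_len, (hw n).2, pow_mul]
  have hM : IsMorseRay π (nearGauge M k c (axD M s)) γ := by
    refine ⟨hray, fun n => ?_⟩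
    obtain ⟨N, hN⟩ := hcv n
    obtain ⟨h1, h2⟩ := hN N le_rfl
    have := h.morse1 hgen hsym (geo_wordPath hgen hsym (hw N).1)
      (.inl ⟨wordPath_zero _, hend N⟩)
    exact mp_congr (mp_mono this h1) 1 fun i hi => by rw [one_mul, h2 i hi]
  refine ⟨g ^ p, γ, hM, h.morseElement hgen hsym p hp, ⟨_, γ, hM, rfl, w, hw, hcv⟩, ?_⟩
  intro t ht
  set E := ⌈nearConst M k c 1 0 s⌉₊ with hE
  obtain ⟨N, hN⟩ := hcv (t + E)
  obtain ⟨h1, h2⟩ := hN (max N t) (le_max_left _ _)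
  set n := max N t with hn
  have geo := geo_wordPath hgen hsym (hw n).1
  have hn' : (wordDist π (wordPath π (w n) (w n).length) (q (s + (p * n) * P)) : ℝ) ≤ s := by
    rw [hend]; exact_mod_cast h.ne _
  have h0 : (wordDist π (wordPath π (w n) 0) (q 0) : ℝ) ≤ s := by
    rw [h.q0, wordPath_zero, wd_self]; simp
  obtain ⟨l, hl, hd⟩ := near2_ord hgen hsym (h.mp (s + (p * n) * P)) h.hk h.hc (h.qg _) le_rfl
    le_rfl geo (Nat.zero_le _) le_rfl h0 hn' t (Nat.zero_le _)
    (by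
      have a1 := Nat.le_mul_of_pos_left n hp
      have a2 := Nat.le_mul_of_pos_right (p * n) h.hP
      have a3 : t ≤ n := le_max_right _ _
      omega)
  have hd' : wordDist π (q t) (wordPath π (w n) l) ≤ E := by
    exact_mod_cast hd.trans (Nat.le_ceil _)
  have e1 := geo_dist geo (Nat.zero_le l) hl
  rw [wordPath_zero] at e1
  have t1 := wd_tri hgen 1 (q t) (wordPath π (w n) l)
  have t2 := wd_tri hgen 1 (wordPath π (w n) l) (q t)
  rw [wd_comm hgen hsym (wordPath π (w n) l)] at t2
  have e2 := h2 l (by omega)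
  rw [e2] at hd'
  have t3 := wd_tri hgen (q t) (γ l) (γ t)
  have e3 := hray.2 l t
  rw [e2] at t1 t2
  rw [e2] at e1
  unfold Nat.dist at e3
  omega

/-- the periodic path following `γ` up to time `s` and then looping between `s` and `s+P` -/
def loopPath (γ : ℕ → G) (s P : ℕ) (i : ℕ) : G :=
  if i < s then γ i else (γ (s + P) * (γ s)⁻¹) ^ ((i - s) / P) * γ (s + (i - s) % P)

lemma loop_eq {γ : ℕ → G} {s P L : ℕ} (hLP : L < P)
    (hpat : ∀ r ≤ L, (γ (s + P))⁻¹ * γ (s + P + r) = (γ s)⁻¹ * γ (s + r)) {i : ℕ}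
    (hi : i ≤ s + P + L) : loopPath γ s P i = γ i := by
  unfold loopPath
  split_ifs with h
  · rfl
  by_cases h2 : i < s + P
  · have e : i - s < P := by omega
    rw [Nat.div_eq_of_lt e, Nat.mod_eq_of_lt e]
    simp; congr 1; omega
  · obtain ⟨r, rfl⟩ : ∃ r, i = s + P + r := ⟨i - (s + P), by omega⟩
    have e : s + P + r - s = r + P := by omega
    have hr : r < P := by omega
    rw [e, Nat.add_div_right _ (by omega), Nat.add_mod_right, Nat.div_eq_of_lt hr,
      Nat.mod_eq_of_lt hr, pow_one, mul_assoc, ← hpat r (by omega)]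
    group

lemma loop_window {γ : ℕ → G} {s P L : ℕ} (hLP : L < P)
    (hpat : ∀ r ≤ L, (γ (s + P))⁻¹ * γ (s + P + r) = (γ s)⁻¹ * γ (s + r)) (i : ℕ) :
    ∃ (x : G) (i0 : ℕ), ∀ t ≤ L, loopPath γ s P (i + t) = x * γ (i0 + t) := by
  by_cases h : i < s
  · exact ⟨1, i, fun t ht => by rw [one_mul]; exact loop_eq hLP hpat (by omega)⟩
  · refine ⟨(γ (s + P) * (γ s)⁻¹) ^ ((i - s) / P), s + (i - s) % P, fun t ht => ?_⟩
    have hm : (i - s) % P < P := Nat.mod_lt _ (by omega)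
    rw [← loop_eq hLP hpat (i := s + (i - s) % P + t) (by omega)]
    have hdm := Nat.div_add_mod (i - s) P
    have e : i + t - s = ((i - s) % P + t) + P * ((i - s) / P) := by omega
    have e' : s + (i - s) % P + t - s = (i - s) % P + t := by omega
    unfold loopPath
    rw [if_neg (by omega), if_neg (by omega), e, e', Nat.add_mul_div_left _ _ (by omega),
      Nat.add_mul_mod_self_left, ← mul_assoc, ← pow_add, Nat.add_comm ((i - s) / P)]

lemma loop_Ax (hgen : Generates π) (hsym : SymmetricGen π) {M M' : MorseGauge} {B k' c' : ℝ}
    (hk' : 1 ≤ k') (hc' : 0 ≤ c')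
    (hB : ∀ (q : ℕ → G) (n : ℕ), IsLocalMorseQG π B M 1 0 q n →
        IsDiscreteQG π k' c' q n ∧ IsMorsePath π M' q n)
    {γ : ℕ → G} (hγ : IsMorseRay π M γ) {s P L : ℕ} (hBL : B ≤ L) (hLP : L < P)
    (hpat : ∀ r ≤ L, (γ (s + P))⁻¹ * γ (s + P + r) = (γ s)⁻¹ * γ (s + r)) :
    Ax π M' k' c' s P (γ (s + P) * (γ s)⁻¹) (loopPath γ s P) := by
  have hloc : ∀ n, IsLocalMorseQG π B M 1 0 (loopPath γ s P) n := by
    intro n i j hij hj hl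
    have hl' : j - i ≤ L := by
      have : ((j - i : ℕ) : ℝ) ≤ L := by rw [Nat.cast_sub hij]; linarith
      exact_mod_cast this
    obtain ⟨x, i0, hx⟩ := loop_window hLP hpat i
    have e : i0 + (j - i) - i0 = j - i := by omega
    constructor
    · have h1 : IsDiscreteQG π 1 0 γ (i0 + (j - i)) :=
        (geo_iff _ _).2 fun a _ b _ => hγ.1.2 a b
      have h2 := qg_shift h1 (i := i0) (by omega) le_rfl
      rw [e] at h2
      exact qg_congr h2 x fun t ht => hx t (ht.trans hl')
    · have h2 := mp_shift (hγ.2 (i0 + (j - i))) (i := i0) (by omega) le_rfl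
      rw [e] at h2
      exact mp_congr h2 x fun t ht => hx t (ht.trans hl')
  have hγl : ∀ i, wordDist π 1 (γ i) = i := by
    intro i
    have := hγ.1.2 0 i
    rw [hγ.1.1] at this
    rw [this]; simp [Nat.dist]
  refine ⟨hk', hc', by omega, ?_, fun N => (hB _ _ (hloc N)).1, fun N => (hB _ _ (hloc N)).2,
    ?_, ?_⟩
  · rw [loop_eq hLP hpat (by omega), hγ.1.1]
  · intro n
    have e : loopPath γ s P (s + n * P) = (γ (s + P) * (γ s)⁻¹) ^ n * γ s := by
      unfold loopPath
      rw [if_neg (by omega), Nat.add_sub_cancel_left, Nat.mul_div_cancel _ (by omega),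
        Nat.mul_mod_left, Nat.add_zero]
    rw [e, wordDist, inv_mul_cancel_left, ← wd_one, hγl]
  · refine ⟨s + P, fun i => ?_⟩
    by_cases h : i < s
    · refine ⟨0, ?_⟩
      rw [loop_eq hLP hpat (by omega), pow_zero, wd_comm hgen hsym, hγl]; omega
    · refine ⟨(i - s) / P, ?_⟩
      have hm : (i - s) % P < P := Nat.mod_lt _ (by omega)
      unfold loopPath
      rw [if_neg h, wd_comm hgen hsym, wordDist, inv_mul_cancel_left, ← wd_one, hγl]; omega

/-- infinitely many repetitions of some pattern of length `L` -/
lemma exists_pattern [Fintype A] (hgen : Generates π) {γ : ℕ → G} (hγ : IsRay π γ) (L : ℕ) :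
    ∃ s, ∀ n, ∃ P, n ≤ P ∧ L < P ∧
      ∀ r ≤ L, (γ (s + P))⁻¹ * γ (s + P + r) = (γ s)⁻¹ * γ (s + r) := by
  have fin : Finite {b : G // wordLength π b ≤ L} := (ball_finite hgen L).to_subtype
  have bd : ∀ (n : ℕ) (r : Fin (L + 1)), wordLength π ((γ n)⁻¹ * γ (n + r)) ≤ L := by
    intro n r
    have := hγ.2 n (n + r)
    rw [wordDist, Nat.dist_eq_sub_of_le (by omega)] at this
    omega
  obtain ⟨y, hy⟩ := Finite.exists_infinite_fiber
    (fun (n : ℕ) (r : Fin (L + 1)) => (⟨_, bd n r⟩ : {b : G // wordLength π b ≤ L}))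
  have hinf := Set.infinite_coe_iff.1 hy
  obtain ⟨s, hs⟩ := hinf.nonempty
  refine ⟨s, fun n => ?_⟩
  obtain ⟨t, ht, htn⟩ := hinf.exists_gt (s + n + L)
  refine ⟨t - s, by omega, by omega, fun r hr => ?_⟩
  have e : s + (t - s) = t := by omega
  rw [e]
  have h1 : _ = _ := ht
  have h2 : _ = _ := hs
  have := congrArg Subtype.val (congrFun (h1.trans h2.symm) ⟨r, by omega⟩)
  simpa using this

/-- compactness: extract a limit ray -/
lemma limit_mem [Fintype A] (hgen : Generates π) {M₁ M : MorseGauge} {γ : ℕ → G}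
    (hγ : IsMorseRay π M₁ γ) (δ : ℕ → ℕ → G) (hδ : ∀ j, IsMorseRay π M (δ j)) (C : ℕ)
    (hC : ∀ j, ∀ t ≤ j, wordDist π (γ t) (δ j t) ≤ C)
    (U : Set (MorseBoundary π)) (hU : (boundaryTop π).IsOpen U)
    (hmem : mkBoundary π γ M₁ hγ ∈ U) : ∃ j, mkBoundary π (δ j) M (hδ j) ∈ U := by
  let F : Ultrafilter ℕ := Filter.hyperfilter ℕ
  have ev : ∀ t, ∃ y, ∀ᶠ j in (F : Filter ℕ), δ j t = y := by
    intro t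
    have h1 : ∀ᶠ j in (F : Filter ℕ), ∃ y ∈ {g : G | wordLength π g ≤ t}, δ j t = y := by
      refine Filter.Eventually.of_forall fun j => ⟨_, ?_, rfl⟩
      have := (hδ j).1.2 0 t
      rw [(hδ j).1.1, wd_one] at this
      change wordLength π (δ j t) ≤ t
      rw [this]; simp [Nat.dist]
    obtain ⟨y, -, hy⟩ := (Ultrafilter.eventually_exists_mem_iff (ball_finite hgen t)).1 h1
    exact ⟨y, hy⟩
  choose ε hε using ev
  have evN : ∀ n, ∀ᶠ j in (F : Filter ℕ), ∀ t ≤ n, δ j t = ε t := by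
    intro n
    have := (Filter.eventually_all_finite (Set.finite_Iic n)).2 fun t _ => hε t
    exact this
  have large : ∀ n : ℕ, ∀ᶠ j in (F : Filter ℕ), n ≤ j := fun n =>
    (Filter.eventually_ge_atTop n).filter_mono Nat.hyperfilter_le_atTop
  have hεM : IsMorseRay π M ε := by
    refine ⟨⟨?_, fun i j => ?_⟩, fun n => ?_⟩
    · obtain ⟨j, hj⟩ := (hε 0).exists
      rw [← hj]; exact (hδ j).1.1
    · obtain ⟨l, hl⟩ := (evN (max i j)).exists
      rw [← hl i (le_max_left _ _), ← hl j (le_max_right _ _)]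
      exact (hδ l).1.2 i j
    · obtain ⟨j, hj⟩ := (evN n).exists
      exact mp_congr ((hδ j).2 n) 1 fun i hi => by rw [one_mul, hj i hi]
  have hεγ : mkBoundary π ε M hεM = mkBoundary π γ M₁ hγ := by
    refine (Quot.sound ?_).symm
    refine ⟨C, fun n => ?_⟩
    obtain ⟨j, h1, h2⟩ := ((hε n).and (large n)).exists
    have := hC j n h2
    rwa [h1] at this
  have hopen : (stratumTop π M).IsOpen
      ((fun γ : {γ : ℕ → G // IsMorseRay π M γ} => mkBoundary π γ.1 M γ.2) ⁻¹' U) := by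
    have := (isOpen_iSup_iff.1 hU) M
    exact isOpen_coinduced.1 this
  letI tG : TopologicalSpace G := ⊥
  haveI : DiscreteTopology G := ⟨rfl⟩
  have hopen' : IsOpen
      ((fun γ : {γ : ℕ → G // IsMorseRay π M γ} => mkBoundary π γ.1 M γ.2) ⁻¹' U) := hopen
  have tend : Filter.Tendsto (fun j => (⟨δ j, hδ j⟩ : {γ : ℕ → G // IsMorseRay π M γ})) F
      (nhds ⟨ε, hεM⟩) := by
    rw [tendsto_subtype_rng, tendsto_pi_nhds]
    intro t
    rw [nhds_discrete, Filter.tendsto_pure]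
    exact hε t
  have hin := tend.eventually (hopen'.mem_nhds (by
    change mkBoundary π ε M hεM ∈ U
    rw [hεγ]; exact hmem))
  exact hin.exists

end rays

/-- For a Morse local-to-global group, the set of attracting
fixed points of Morse elements is dense in the Morse boundary: every nonempty
open set contains some `g⁺`. -/
theorem dense_plus_points {G : Type} [Group G] {A : Type} [Fintype A]
    (π : A → G) (hgen : Generates π) (hsym : SymmetricGen π)
    (hltg : MorseLocalToGlobal π) :
    ∀ U : Set (MorseBoundary π), (boundaryTop π).IsOpen U → U.Nonempty →
      ∃ (g : G) (x : MorseBoundary π),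
        IsMorseElement π g ∧ IsPlusPoint π g x ∧ x ∈ U := by
  intro U hU hne
  obtain ⟨x, hx⟩ := hne
  obtain ⟨⟨γ, M, hγ⟩, rfl⟩ := Quot.exists_rep x
  obtain ⟨B, M', k', c', -, hk', hc', hB⟩ := hltg M 1 0 le_rfl le_rfl
  obtain ⟨s, hs⟩ := exists_pattern hgen hγ.1 ⌈B⌉₊
  choose P hnP hLP hpat using hs
  have hAx := fun j => loop_Ax hgen hsym hk' hc' hB hγ (Nat.le_ceil B) (hLP j) (hpat j)
  choose g δ hδ hme hpp hcl using fun j => (hAx j).plus hgen hsym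
  obtain ⟨j, hj⟩ := limit_mem hgen hγ δ hδ (2 * ⌈nearConst M' k' c' 1 0 s⌉₊) (by
    intro j t ht
    have e := loop_eq (hLP j) (hpat j) (i := t) (by have := hnP j; omega)
    have h1 := hcl j t
    rw [e] at h1
    apply h1
    have := hγ.1.2 0 t
    rw [hγ.1.1] at this
    rw [this]; simp [Nat.dist]) U hU hx
  exact ⟨g j, _, hme j, hpp j, hj⟩
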